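/- The new smoothing function s₃^{#}(r) = erf(r) − (2/9)·r·(9 + 6r² − 4r⁴)·e^{−r²}/√π satisfies the moment condition ∫₀^∞ r²(s₃^{#}(r) − 1) dr = 0. -/

import Mathlib

open MeasureTheory Real Filter

/-- The error function `erf(r) = (2/√π) ∫₀^r e^{−t²} dt`. -/
noncomputable def erf (r : ℝ) : ℝ :=
  (2 / Real.sqrt Real.pi) * ∫ t in (0:ℝ)..r, Real.exp (-t ^ 2)

/-- The new smoothing function `s₃^{#}(r) = erf(r) − (2/9)r(9 + 6r² − 4r⁴)e^{−r²}/√π`. -/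
noncomputable def s3SharpNew (r : ℝ) : ℝ :=
  erf r - (2 / 9) * r * (9 + 6 * r ^ 2 - 4 * r ^ 4) * Real.exp (-r ^ 2) / Real.sqrt Real.pi

theorem hasDerivAt_erf (r : ℝ) : HasDerivAt erf (2 / √π * exp (-r ^ 2)) r := by
  have hc : Continuous fun t : ℝ => exp (-t ^ 2) := by fun_prop
  exact (intervalIntegral.integral_hasDerivAt_right (hc.intervalIntegrable _ _)
    (hc.stronglyMeasurableAtFilter _ _) hc.continuousAt).const_mul _

theorem continuous_erf : Continuous erf :=
  continuous_iff_continuousAt.2 fun r => (hasDerivAt_erf r).continuousAt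

theorem integrable_exp_neg_sq : Integrable fun t : ℝ => exp (-t ^ 2) := by
  simpa using integrable_exp_neg_mul_sq one_pos

theorem one_sub_erf (r : ℝ) : 1 - erf r = 2 / √π * ∫ t in Set.Ioi r, exp (-t ^ 2) := by
  have hsplit := intervalIntegral.integral_interval_add_Ioi
    (integrable_exp_neg_sq.integrableOn (s := Set.Ioi (0 : ℝ)))
    (integrable_exp_neg_sq.integrableOn (s := Set.Ioi r))
  have htotal : ∫ t in Set.Ioi (0 : ℝ), exp (-t ^ 2) = √π / 2 := by
    simpa using integral_gaussian_Ioi 1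
  have hpi : √π ≠ 0 := by positivity
  have hone : 2 / √π * (√π / 2) = 1 := by field_simp
  rw [← hone, ← htotal, ← hsplit, erf]
  ring

theorem exp_neg_sq_le_exp_neg {r : ℝ} (hr : 1 ≤ r) : exp (-r ^ 2) ≤ exp (-r) :=
  exp_le_exp.2 (by nlinarith)

theorem isBigO_exp_neg_sq : (fun r : ℝ => exp (-r ^ 2)) =O[atTop] fun r => exp (-r) := by
  refine Asymptotics.IsBigO.of_bound 1 ?_
  filter_upwards [eventually_ge_atTop 1] with r hr
  simpa using exp_neg_sq_le_exp_neg hr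

theorem isBigO_erf_sub_one : (fun r => erf r - 1) =O[atTop] fun r => exp (-r) := by
  refine Asymptotics.IsBigO.of_bound (2 / √π) ?_
  filter_upwards [eventually_ge_atTop 1] with r hr
  rw [norm_sub_rev, one_sub_erf, norm_of_nonneg (by positivity), norm_of_nonneg (exp_pos _).le,
    ← integral_exp_neg_Ioi r]
  refine mul_le_mul_of_nonneg_left ?_ (by positivity)
  exact setIntegral_mono_on integrable_exp_neg_sq.integrableOn (integrableOn_exp_neg_Ioi r)
    measurableSet_Ioi fun t ht => exp_neg_sq_le_exp_neg (hr.trans (le_of_lt ht))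

theorem isBigO_pow_mul_of_isBigO_exp_neg {g : ℝ → ℝ} (hg : g =O[atTop] fun r => exp (-r))
    (n : ℕ) : (fun r => r ^ n * g r) =O[atTop] fun r => exp (-(1 / 2) * r) := by
  have hpow := (isLittleO_pow_exp_pos_mul_atTop n (b := 1 / 2) (by norm_num)).isBigO
  refine (hpow.mul hg).congr_right fun r => ?_
  rw [← exp_add]
  ring_nf

/-- An antiderivative of `r ↦ r ^ 2 * (s3SharpNew r - 1)`. -/
noncomputable def secondMomentPrimitive (r : ℝ) : ℝ :=
  1 / 3 * (r ^ 3 * (erf r - 1)) -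
    (4 / 9 * (r ^ 6 * exp (-r ^ 2)) + 2 / 3 * (r ^ 4 * exp (-r ^ 2))) / √π

theorem hasDerivAt_secondMomentPrimitive (r : ℝ) :
    HasDerivAt secondMomentPrimitive (r ^ 2 * (s3SharpNew r - 1)) r := by
  have hexp : HasDerivAt (fun t : ℝ => exp (-t ^ 2)) (exp (-r ^ 2) * -(2 * r)) r := by
    simpa using (hasDerivAt_pow 2 r).neg.exp
  have h := (((hasDerivAt_pow 3 r).mul ((hasDerivAt_erf r).sub_const 1)).const_mul (1 / 3)).sub
    (((((hasDerivAt_pow 6 r).mul hexp).const_mul (4 / 9)).add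
      (((hasDerivAt_pow 4 r).mul hexp).const_mul (2 / 3))).div_const √π)
  refine h.congr_deriv ?_
  rw [s3SharpNew]
  push_cast
  ring

theorem tendsto_secondMomentPrimitive : Tendsto secondMomentPrimitive atTop (nhds 0) := by
  have hbig : secondMomentPrimitive =O[atTop] fun r => exp (-(1 / 2) * r) := by
    refine ((isBigO_pow_mul_of_isBigO_exp_neg isBigO_erf_sub_one 3).const_mul_left (1 / 3)).sub ?_
    simp only [div_eq_inv_mul _ √π]
    exact (((isBigO_pow_mul_of_isBigO_exp_neg isBigO_exp_neg_sq 6).const_mul_left _).add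
      ((isBigO_pow_mul_of_isBigO_exp_neg isBigO_exp_neg_sq 4).const_mul_left _)).const_mul_left _
  refine hbig.trans_tendsto (tendsto_exp_atBot.comp ?_)
  exact tendsto_id.const_mul_atTop_of_neg (by norm_num)

theorem integrableOn_sq_mul_s3SharpNew_sub_one :
    IntegrableOn (fun r => r ^ 2 * (s3SharpNew r - 1)) (Set.Ioi 0) := by
  refine integrable_of_isBigO_exp_neg (b := 1 / 2) (by norm_num) ?_ ?_
  · have := continuous_erf
    unfold s3SharpNew
    fun_prop
  · have hexp (n : ℕ) := isBigO_pow_mul_of_isBigO_exp_neg isBigO_exp_neg_sq n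
    refine ((isBigO_pow_mul_of_isBigO_exp_neg isBigO_erf_sub_one 2).add
      ((((hexp 7).const_mul_left (8 / 9 / √π)).sub ((hexp 5).const_mul_left (4 / 3 / √π))).sub
        ((hexp 3).const_mul_left (2 / √π)))).congr_left fun r => ?_
    rw [s3SharpNew]
    ring

/-- `∫₀^∞ r²(s₃^{#}(r) − 1) dr = 0` for the new smoothing function. -/
theorem second_moment_s3SharpNew :
    ∫ r in Set.Ioi (0:ℝ), r ^ 2 * (s3SharpNew r - 1) = 0 := by
  rw [integral_Ioi_of_hasDerivAt_of_tendsto' (fun r _ => hasDerivAt_secondMomentPrimitive r)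
    integrableOn_sq_mul_s3SharpNew_sub_one tendsto_secondMomentPrimitive]
  simp [secondMomentPrimitive]
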